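/- arXiv:math/0601405 — 9 statements merged into one kernel-verified Lean document; each statement's English description precedes it below -/
import Mathlib

section
/- An irrational real number θ is a quadratic irrationality (i.e., a root of a quadratic equation with rational coefficients) if and only if there exists a matrix g = [[a,b],[c,d]] in SL₂(ℤ) with g ≠ I and g ≠ -I such that (a·θ + b)/(c·θ + d) = θ. -/
lemma Irrational.intCast_mul_add_eq_zero {θ : ℝ} (hθ : Irrational θ) {m n : ℤ}
    (h : (m : ℝ) * θ + n = 0) : m = 0 ∧ n = 0 := by
  have hm : m = 0 := by
    by_contra hm
    exact ((hθ.intCast_mul hm).add_intCast n).ne_zero h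
  subst hm
  exact ⟨rfl, by simpa using h⟩

lemma exists_int_quadratic_of_rat_quadratic {θ : ℝ} {a b c : ℚ} (ha : a ≠ 0)
    (h : (a : ℝ) * θ ^ 2 + b * θ + c = 0) :
    ∃ A B C : ℤ, A ≠ 0 ∧ (A : ℝ) * θ ^ 2 + B * θ + C = 0 := by
  refine ⟨a.num * b.den * c.den, b.num * a.den * c.den, c.num * a.den * b.den, ?_, ?_⟩
  · simp [ha]
  · rw [Rat.cast_def a, Rat.cast_def b, Rat.cast_def c] at h
    have h₁ : (a.den : ℝ) ≠ 0 := by simp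
    have h₂ : (b.den : ℝ) ≠ 0 := by simp
    have h₃ : (c.den : ℝ) ≠ 0 := by simp
    field_simp at h
    push_cast
    linear_combination h

lemma exists_pell_solution_discrim {θ : ℝ} (hθ : Irrational θ) {A B C : ℤ} (hA : A ≠ 0)
    (h : (A : ℝ) * θ ^ 2 + B * θ + C = 0) :
    ∃ x y : ℤ, x ^ 2 - discrim A B C * y ^ 2 = 1 ∧ y ≠ 0 := by
  have hirr : Irrational (((2 * A : ℤ) : ℝ) * θ + B) :=
    (hθ.intCast_mul (by simpa using hA)).add_intCast B
  have hsq : ((discrim A B C : ℤ) : ℝ) = (((2 * A : ℤ) : ℝ) * θ + B) ^ 2 := by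
    rw [discrim]
    push_cast
    linear_combination -(4 * (A : ℝ)) * h
  refine Pell.exists_of_not_isSquare ?_ ?_
  · have : (0 : ℝ) < (discrim A B C : ℤ) := hsq ▸ sq_pos_of_ne_zero hirr.ne_zero
    exact_mod_cast this
  · rintro ⟨r, hr⟩
    rw [hr, Int.cast_mul, ← sq, sq_eq_sq_iff_eq_or_eq_neg] at hsq
    rcases hsq with hs | hs
    · exact hirr.ne_int r hs.symm
    · exact hirr.ne_int (-r) (by push_cast at hs ⊢; linarith)

/-- An irrational real number `θ` is a quadratic irrationality (a root of a quadratic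
equation with rational coefficients) if and only if there exists `g ∈ SL₂(ℤ)`,
`g ≠ ±I`, fixing `θ` under the Möbius action. -/
theorem stmt_0 (θ : ℝ) (hθ : Irrational θ) :
    (∃ a b c : ℚ, a ≠ 0 ∧ (a : ℝ) * θ ^ 2 + (b : ℝ) * θ + (c : ℝ) = 0) ↔
    (∃ g : Matrix.SpecialLinearGroup (Fin 2) ℤ,
      g.1 ≠ 1 ∧ g.1 ≠ -1 ∧
      ((g.1 0 0 : ℝ) * θ + (g.1 0 1 : ℝ)) / ((g.1 1 0 : ℝ) * θ + (g.1 1 1 : ℝ)) = θ) := by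
  constructor
  · rintro ⟨a, b, c, ha, h⟩
    obtain ⟨A, B, C, hA, hABC⟩ := exists_int_quadratic_of_rat_quadratic ha h
    obtain ⟨x, y, hxy, hy⟩ := exists_pell_solution_discrim hθ hA hABC
    have hc : 2 * A * y ≠ 0 := by simp [hA, hy]
    refine ⟨⟨!![x - B * y, -2 * C * y; 2 * A * y, x + B * y], ?_⟩, ?_, ?_, ?_⟩
    · rw [Matrix.det_fin_two_of]
      rw [discrim] at hxy
      linear_combination hxy
    · intro h1
      exact hc (by simpa using congrFun (congrFun h1 1) 0)
    · intro h1
      exact hc (by simpa using congrFun (congrFun h1 1) 0)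
    · have hden : ((2 * A * y : ℤ) : ℝ) * θ + ((x + B * y : ℤ) : ℝ) ≠ 0 := fun h0 =>
        hc (hθ.intCast_mul_add_eq_zero h0).1
      simp only [Matrix.of_apply, Matrix.cons_val', Matrix.cons_val_zero, Matrix.cons_val_one,
        Matrix.cons_val_fin_one]
      rw [div_eq_iff hden]
      push_cast
      linear_combination -2 * (y : ℝ) * hABC
  · rintro ⟨g, h1, h2, h⟩
    have hdet := g.2
    rw [Matrix.det_fin_two] at hdet
    have hden : (g.1 1 0 : ℝ) * θ + (g.1 1 1 : ℝ) ≠ 0 := by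
      intro h0
      rw [h0, div_zero] at h
      exact hθ.ne_zero h.symm
    rw [div_eq_iff hden] at h
    refine ⟨g.1 1 0, g.1 1 1 - g.1 0 0, -g.1 0 1, ?_, ?_⟩
    · intro hc
      have hc : g.1 1 0 = 0 := by exact_mod_cast hc
      have hlin : ((g.1 0 0 - g.1 1 1 : ℤ) : ℝ) * θ + (g.1 0 1 : ℝ) = 0 := by
        rw [hc] at h
        push_cast at h ⊢
        linear_combination h
      obtain ⟨had, hb⟩ := hθ.intCast_mul_add_eq_zero hlin
      have had : g.1 0 0 = g.1 1 1 := sub_eq_zero.mp had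
      rw [hc, had, mul_zero, sub_zero] at hdet
      rcases mul_self_eq_one_iff.mp hdet with hd | hd
      · apply h1
        ext i j
        fin_cases i <;> fin_cases j <;> simp [hc, had, hb, hd]
      · apply h2
        ext i j
        fin_cases i <;> fin_cases j <;> simp [hc, had, hb, hd]
    · push_cast
      linear_combination -h
end

section
/- For every quadratic irrationality θ, the set S_θ = { g = [[a,b],[c,d]] ∈ SL₂(ℤ) : g ≠ ±I, (aθ+b)/(cθ+d) = θ, a+d > 0, and c > 0 } is nonempty. -/
/-- A real root of a quadratic polynomial over `ℚ` is a root of a quadratic polynomial over `ℤ`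
with positive leading coefficient. -/
theorem exists_int_quadratic_of_rat (θ : ℝ)
    (hquad : ∃ a b c : ℚ, a ≠ 0 ∧ (a : ℝ) * θ ^ 2 + (b : ℝ) * θ + (c : ℝ) = 0) :
    ∃ a b c : ℤ, 0 < a ∧ (a : ℝ) * θ ^ 2 + (b : ℝ) * θ + (c : ℝ) = 0 := by
  obtain ⟨a, b, c, ha, h⟩ := hquad
  have hn : a.num ≠ 0 := Rat.num_ne_zero.mpr ha
  have hb : (0 : ℤ) < b.den := by exact_mod_cast b.pos
  have hc : (0 : ℤ) < c.den := by exact_mod_cast c.pos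
  refine ⟨a.num ^ 2 * b.den * c.den, b.num * a.num * a.den * c.den,
    c.num * a.num * a.den * b.den, by positivity, ?_⟩
  have ha0 : (a.den : ℝ) ≠ 0 := by exact_mod_cast a.den_ne_zero
  have hb0 : (b.den : ℝ) ≠ 0 := by exact_mod_cast b.den_ne_zero
  have hc0 : (c.den : ℝ) ≠ 0 := by exact_mod_cast c.den_ne_zero
  rw [Rat.cast_def a, Rat.cast_def b, Rat.cast_def c] at h
  field_simp at h
  push_cast
  linear_combination (a.num : ℝ) * h

/-- For every quadratic irrationality `θ`, the set `S_θ` is nonempty. -/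
theorem stmt_1 (θ : ℝ) (hθ : Irrational θ)
    (hquad : ∃ a b c : ℚ, a ≠ 0 ∧ (a : ℝ) * θ ^ 2 + (b : ℝ) * θ + (c : ℝ) = 0) :
    ∃ g : Matrix.SpecialLinearGroup (Fin 2) ℤ,
      g.1 ≠ 1 ∧ g.1 ≠ -1 ∧
      ((g.1 0 0 : ℝ) * θ + (g.1 0 1 : ℝ)) / ((g.1 1 0 : ℝ) * θ + (g.1 1 1 : ℝ)) = θ ∧
      0 < g.1 0 0 + g.1 1 1 ∧ 0 < g.1 1 0 := by
  obtain ⟨a, b, c, ha, h⟩ := exists_int_quadratic_of_rat θ hquad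
  have hlin : Irrational (2 * a * θ + b) := by
    simpa using (hθ.intCast_mul (m := 2 * a) (by positivity)).add_intCast b
  have hsq : ((b ^ 2 - 4 * a * c : ℤ) : ℝ) = (2 * a * θ + b) ^ 2 := by
    push_cast
    linear_combination (-4 * (a : ℝ)) * h
  have hpos : 0 < b ^ 2 - 4 * a * c := by
    have : (0 : ℝ) < ((b ^ 2 - 4 * a * c : ℤ) : ℝ) := by
      rw [hsq]
      exact sq_pos_of_ne_zero hlin.ne_zero
    exact_mod_cast this
  have hns : ¬IsSquare (b ^ 2 - 4 * a * c) := by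
    rintro ⟨r, hr⟩
    rw [hr, Int.cast_mul, ← sq] at hsq
    rcases sq_eq_sq_iff_eq_or_eq_neg.mp hsq with h' | h'
    · exact hlin.ne_int r h'.symm
    · exact hlin.ne_int (-r) (by push_cast; linarith)
  obtain ⟨s, hx, hy⟩ := Pell.Solution₁.exists_pos_of_not_isSquare hpos hns
  have hlower : 0 < 2 * a * s.y := by positivity
  refine ⟨⟨!![s.x - b * s.y, -2 * c * s.y; 2 * a * s.y, s.x + b * s.y], ?_⟩, ?_, ?_, ?_, ?_, ?_⟩
  · rw [Matrix.det_fin_two_of]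
    linear_combination s.prop
  · intro h'
    have := congrFun (congrFun h' 1) 0
    simp at this
    grind
  · intro h'
    have := congrFun (congrFun h' 1) 0
    simp at this
    grind
  · have hden : ((2 * a * s.y : ℤ) : ℝ) * θ + ((s.x + b * s.y : ℤ) : ℝ) ≠ 0 :=
      ((hθ.intCast_mul hlower.ne').add_intCast _).ne_zero
    change (((s.x - b * s.y : ℤ) : ℝ) * θ + ((-2 * c * s.y : ℤ) : ℝ)) /
      (((2 * a * s.y : ℤ) : ℝ) * θ + ((s.x + b * s.y : ℤ) : ℝ)) = θ
    rw [div_eq_iff hden]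
    push_cast
    linear_combination (-2 * (s.y : ℝ)) * h
  · change 0 < s.x - b * s.y + (s.x + b * s.y)
    linarith
  · exact hlower
end

section
/- Let g = [[a,b],[c,d]] ∈ SL₂(ℤ) with c > 0 and a + d ≥ 2, and for n ≥ 0 write c_n for the lower-left entry of gⁿ (so c₀ = 0, c₁ = c). Then (c_n)_{n ≥ 1} is a strictly increasing sequence of positive integers: for all n ≥ 1, 0 < c_n < c_{n+1}. -/
/-- The Cayley–Hamilton recurrence for the lower-left entries of the powers of `g ∈ SL₂(R)`. -/
theorem Matrix.SpecialLinearGroup.pow_add_two_apply_one_zero {R : Type*} [CommRing R]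
    (g : Matrix.SpecialLinearGroup (Fin 2) R) (n : ℕ) :
    (g ^ (n + 2)).1 1 0 =
      (g.1 0 0 + g.1 1 1) * (g ^ (n + 1)).1 1 0 - (g ^ n).1 1 0 := by
  have hdet := g.2
  rw [Matrix.det_fin_two] at hdet
  simp only [pow_succ, Matrix.SpecialLinearGroup.coe_mul, Matrix.mul_apply, Fin.sum_univ_two]
  linear_combination -(g ^ n).1 1 0 * hdet

/-- If `g ∈ SL₂(ℤ)` has `c > 0` and `a + d ≥ 2`, then the lower-left entries `c_n`
of `gⁿ` form a strictly increasing sequence of positive integers for `n ≥ 1`. -/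
theorem stmt_6 (g : Matrix.SpecialLinearGroup (Fin 2) ℤ)
    (hc : 0 < g.1 1 0) (htr : 2 ≤ g.1 0 0 + g.1 1 1) :
    ∀ n : ℕ, 1 ≤ n → 0 < (g ^ n).1 1 0 ∧ (g ^ n).1 1 0 < (g ^ (n + 1)).1 1 0 := by
  have key (n : ℕ) : 0 ≤ (g ^ n).1 1 0 ∧ (g ^ n).1 1 0 < (g ^ (n + 1)).1 1 0 := by
    induction n with
    | zero => simpa using hc
    | succ n ih =>
      obtain ⟨h0, h1⟩ := ih
      refine ⟨h0.trans h1.le, ?_⟩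
      rw [g.pow_add_two_apply_one_zero n]
      nlinarith
  rintro (_ | n) hn
  · omega
  · exact ⟨(key n).1.trans_lt (key n).2, (key (n + 1)).2⟩
end

section
/- Let θ be a quadratic irrationality and let g belong to S_θ = { g = [[a,b],[c,d]] ∈ SL₂(ℤ) : g ≠ ±I, (aθ+b)/(cθ+d) = θ, a+d > 0, c > 0 }. Writing gⁿ = [[a_n,b_n],[c_n,d_n]], for every n ≥ 1 one has c_n > 0 and c_n·θ + d_n > 0; in particular c_n·(c_n·θ + d_n) > 0. -/
/-- A matrix of determinant `1` fixing `θ` acts on `(θ, 1)` with eigenvalue `cθ + d`, the other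
eigenvalue being `a - cθ`. Both are positive when the trace is. -/
theorem eigenvalues_pos_of_fixed {a b c d θ : ℝ} (hdet : a * d - b * c = 1)
    (hfix : a * θ + b = θ * (c * θ + d)) (htr : 0 < a + d) :
    0 < c * θ + d ∧ 0 < a - c * θ := by
  have hmul : (c * θ + d) * (a - c * θ) = 1 := by linear_combination hdet + c * hfix
  rcases pos_and_pos_or_neg_and_neg_of_mul_pos (hmul ▸ one_pos) with h | h
  · exact h
  · linarith [h.1, h.2]

/-- If `θ` is a quadratic irrationality and `g ∈ S_θ`, then for all `n ≥ 1` the entries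
of `gⁿ = [[aₙ,bₙ],[cₙ,dₙ]]` satisfy `cₙ > 0`, `cₙθ + dₙ > 0`, hence `cₙ(cₙθ + dₙ) > 0`. -/
theorem stmt_9 (θ : ℝ) (hθ : Irrational θ)
    (hquad : ∃ a b c : ℚ, a ≠ 0 ∧ (a : ℝ) * θ ^ 2 + (b : ℝ) * θ + (c : ℝ) = 0)
    (g : Matrix.SpecialLinearGroup (Fin 2) ℤ)
    (hg1 : g.1 ≠ 1) (hg2 : g.1 ≠ -1)
    (hfix : ((g.1 0 0 : ℝ) * θ + (g.1 0 1 : ℝ)) / ((g.1 1 0 : ℝ) * θ + (g.1 1 1 : ℝ)) = θ)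
    (htr : 0 < g.1 0 0 + g.1 1 1) (hc : 0 < g.1 1 0) :
    ∀ n : ℕ, 1 ≤ n →
      0 < (g ^ n).1 1 0 ∧
      0 < ((g ^ n).1 1 0 : ℝ) * θ + ((g ^ n).1 1 1 : ℝ) ∧
      0 < ((g ^ n).1 1 0 : ℝ) * (((g ^ n).1 1 0 : ℝ) * θ + ((g ^ n).1 1 1 : ℝ)) := by
  have hden : (g.1 1 0 : ℝ) * θ + (g.1 1 1 : ℝ) ≠ 0 := by
    intro h
    rw [h, div_zero] at hfix
    exact hθ.ne_zero hfix.symm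
  rw [div_eq_iff hden] at hfix
  have hdet : (g.1 0 0 : ℝ) * g.1 1 1 - g.1 0 1 * g.1 1 0 = 1 := by
    exact_mod_cast (Matrix.det_fin_two g.1).symm.trans g.2
  have hcR : (0 : ℝ) < g.1 1 0 := by exact_mod_cast hc
  obtain ⟨hpos, hpos'⟩ := eigenvalues_pos_of_fixed hdet hfix (by exact_mod_cast htr)
  suffices H : ∀ n : ℕ, 1 ≤ n → (0 : ℝ) < ((g ^ n).1 1 0 : ℝ) ∧
      0 < ((g ^ n).1 1 0 : ℝ) * θ + ((g ^ n).1 1 1 : ℝ) from fun n hn =>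
    ⟨by exact_mod_cast (H n hn).1, (H n hn).2, mul_pos (H n hn).1 (H n hn).2⟩
  intro n hn
  induction n, hn using Nat.le_induction with
  | base => simpa using And.intro hcR hpos
  | succ n _ ih =>
    obtain ⟨hcn, hen⟩ := ih
    have hentry (j : Fin 2) : ((g ^ (n + 1)).1 1 j : ℝ) =
        (g ^ n).1 1 0 * g.1 0 j + (g ^ n).1 1 1 * g.1 1 j := by
      rw [pow_succ, Matrix.SpecialLinearGroup.coe_mul, Matrix.mul_apply, Fin.sum_univ_two]
      push_cast
      rfl
    rw [hentry, hentry]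
    constructor
    · linear_combination mul_pos hcn hpos' + mul_pos hcR hen
    · linear_combination mul_pos hen hpos - ((g ^ n).1 1 0 : ℝ) * hfix
end

section
/- Let θ be a quadratic irrationality with Galois conjugate θ'. If there exists g = [[a,b],[c,d]] ∈ SL₂(ℤ) with g ≠ ±I, (aθ+b)/(cθ+d) = θ, a+d > 0, c > 0, and c ≥ a + d, then |θ − θ'| < 1. -/
/-- A rational affine relation satisfied by an irrational number is trivial. -/
lemma Irrational.eq_zero_of_ratCast_mul_add_eq_zero {x : ℝ} (hx : Irrational x) {r s : ℚ}
    (h : (r : ℝ) * x + s = 0) : r = 0 ∧ s = 0 := by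
  have hr : r = 0 := by
    by_contra hr
    have hr' : (r : ℝ) ≠ 0 := by exact_mod_cast hr
    refine hx ⟨-s / r, ?_⟩
    push_cast
    field_simp
    linarith
  subst hr
  simpa using h

/-- If some `g ∈ S_θ` satisfies `c ≥ a + d`, then `|θ - θ'| < 1` for the Galois
conjugate `θ'` of the quadratic irrationality `θ`. -/
theorem stmt_10 (θ θ' : ℝ) (hθ : Irrational θ) (hne : θ' ≠ θ) (p q : ℚ)
    (hroot : θ ^ 2 + (p : ℝ) * θ + (q : ℝ) = 0)
    (hroot' : θ' ^ 2 + (p : ℝ) * θ' + (q : ℝ) = 0)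
    (hex : ∃ g : Matrix.SpecialLinearGroup (Fin 2) ℤ,
      g.1 ≠ 1 ∧ g.1 ≠ -1 ∧
      ((g.1 0 0 : ℝ) * θ + (g.1 0 1 : ℝ)) / ((g.1 1 0 : ℝ) * θ + (g.1 1 1 : ℝ)) = θ ∧
      0 < g.1 0 0 + g.1 1 1 ∧ 0 < g.1 1 0 ∧ g.1 0 0 + g.1 1 1 ≤ g.1 1 0) :
    |θ - θ'| < 1 := by
  obtain ⟨g, -, -, hfix, htr, hc, hle⟩ := hex
  have hdet := g.2
  rw [Matrix.det_fin_two] at hdet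
  generalize g.1 0 0 = a at *
  generalize g.1 0 1 = b at *
  generalize g.1 1 0 = c at *
  generalize g.1 1 1 = d at *
  have hden : (c : ℝ) * θ + d ≠ 0 := by
    intro h
    rw [h, div_zero] at hfix
    exact hθ.ne_zero hfix.symm
  rw [div_eq_iff hden] at hfix
  obtain ⟨hp, hq⟩ := hθ.eq_zero_of_ratCast_mul_add_eq_zero
    (r := d - a - c * p) (s := -b - c * q) (by push_cast; linear_combination (-1) * hfix - c * hroot)
  have hp' : (d : ℝ) - a - c * p = 0 := by exact_mod_cast hp
  have hq' : -(b : ℝ) - c * q = 0 := by exact_mod_cast hq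
  have hdet' : (a : ℝ) * d - b * c = 1 := by exact_mod_cast hdet
  have htr' : (0 : ℝ) < a + d := by exact_mod_cast htr
  have hc' : (0 : ℝ) < c := by exact_mod_cast hc
  have hle' : (a : ℝ) + d ≤ c := by exact_mod_cast hle
  have hsum : θ + θ' + p = 0 := by
    apply mul_left_cancel₀ (sub_ne_zero.mpr hne)
    linear_combination hroot' - hroot
  have hdisc : (c * (θ - θ')) ^ 2 = ((a : ℝ) + d) ^ 2 - 4 := by
    obtain rfl : θ' = -p - θ := by linarith
    have hcp : (c : ℝ) * p = d - a := by linarith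
    have hcq : (c : ℝ) * q = -b := by linarith
    linear_combination 4 * (c : ℝ) ^ 2 * hroot + (c * p + d - a) * hcp - 4 * c * hcq - 4 * hdet'
  have habs : |c * (θ - θ')| < c := abs_lt_of_sq_lt_sq (by nlinarith) hc'.le
  rw [abs_mul, abs_of_pos hc'] at habs
  exact lt_of_mul_lt_mul_left (by linarith) hc'.le
end

section
/- Let θ be a quadratic irrationality with Galois conjugate θ' satisfying |θ − θ'| < 1. Then for every integer ε with 0 ≤ ε ≤ 2 there exists g = [[a,b],[c,d]] ∈ SL₂(ℤ) with g ≠ ±I, (aθ+b)/(cθ+d) = θ, a+d > 0, c > 0, and c > a + d + ε. -/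
theorem Irrational.int_mul_add_int_ne_zero {θ : ℝ} (hθ : Irrational θ) {m : ℤ} (hm : m ≠ 0)
    (l : ℤ) : (m : ℝ) * θ + l ≠ 0 :=
  ((hθ.intCast_mul hm).add_intCast l).ne_zero

/-- The integral form of a monic rational quadratic with roots `θ, θ'` at distance less than `1`:
its discriminant is smaller than the square of the leading coefficient. -/
theorem exists_int_quadratic_of_conj_dist_lt_one {θ θ' : ℝ} (hne : θ' ≠ θ) {p q : ℚ}
    (hroot : θ ^ 2 + (p : ℝ) * θ + (q : ℝ) = 0)
    (hroot' : θ' ^ 2 + (p : ℝ) * θ' + (q : ℝ) = 0) (hlt : |θ - θ'| < 1) :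
    ∃ A B C : ℤ, 0 < A ∧ (A : ℝ) * θ ^ 2 + B * θ + C = 0 ∧ B ^ 2 - 4 * A * C < A ^ 2 := by
  have hp : (p : ℝ) * p.den = p.num := by exact_mod_cast p.mul_den_eq_num
  have hq : (q : ℝ) * q.den = q.num := by exact_mod_cast q.mul_den_eq_num
  have hpd : (0 : ℝ) < p.den := by exact_mod_cast p.den_pos
  have hqd : (0 : ℝ) < q.den := by exact_mod_cast q.den_pos
  refine ⟨p.den * q.den, p.num * q.den, q.num * p.den, ?_, ?_, ?_⟩
  · exact_mod_cast Nat.mul_pos p.den_pos q.den_pos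
  · push_cast
    rw [← hp, ← hq]
    linear_combination (p.den * q.den : ℝ) * hroot
  · have hsum : θ + θ' + p = 0 := by
      apply mul_left_cancel₀ (sub_ne_zero.mpr hne)
      linear_combination hroot' - hroot
    have hdisc : (p : ℝ) ^ 2 - 4 * q = (θ - θ') ^ 2 := by
      linear_combination (p + θ + θ') * hsum - 2 * hroot - 2 * hroot'
    have hsq : (θ - θ') ^ 2 < 1 := (sq_lt_one_iff_abs_lt_one _).mpr hlt
    have key : ((p.num * q.den : ℝ)) ^ 2 - 4 * (p.den * q.den) * (q.num * p.den)
        < (p.den * q.den) ^ 2 := by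
      have h := mul_lt_mul_of_pos_left hsq (pow_pos (mul_pos hpd hqd) 2)
      rw [← hdisc] at h
      rw [← hp, ← hq]
      linarith
    exact_mod_cast key

/-- An integral quadratic with an irrational real root has Pell solutions with `y` large. -/
theorem exists_pell_of_irrational_root {θ : ℝ} (hθ : Irrational θ) {A B C : ℤ} (hA : A ≠ 0)
    (h : (A : ℝ) * θ ^ 2 + B * θ + C = 0) {M : ℤ} (hM : 0 < M) :
    ∃ x y : ℤ, 0 < x ∧ M ≤ y ∧ x ^ 2 - (B ^ 2 - 4 * A * C) * y ^ 2 = 1 := by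
  have hD : ((2 * A * θ + B) * M) ^ 2 = (((B ^ 2 - 4 * A * C) * M ^ 2 : ℤ) : ℝ) := by
    push_cast
    linear_combination 4 * (A : ℝ) * M ^ 2 * h
  have hne (k : ℤ) : (2 * A * θ + B) * M ≠ k := by
    intro hk
    apply hθ.int_mul_add_int_ne_zero (m := 2 * A * M) (by positivity) (B * M - k)
    push_cast
    linear_combination hk
  have hpos : 0 < (B ^ 2 - 4 * A * C) * M ^ 2 := by
    have h0 : (2 * A * θ + B) * M ≠ 0 := by simpa using hne 0
    have : (0 : ℝ) < (((B ^ 2 - 4 * A * C) * M ^ 2 : ℤ) : ℝ) := hD ▸ by positivity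
    exact_mod_cast this
  have hnsq : ¬ IsSquare ((B ^ 2 - 4 * A * C) * M ^ 2) := by
    rintro ⟨k, hk⟩
    rw [hk, Int.cast_mul, ← sq] at hD
    rcases sq_eq_sq_iff_eq_or_eq_neg.mp hD with h1 | h1
    · exact hne k h1
    · exact hne (-k) (by simpa using h1)
  obtain ⟨a, hx, hy⟩ := Pell.Solution₁.exists_pos_of_not_isSquare hpos hnsq
  refine ⟨a.x, M * a.y, by omega, by nlinarith, ?_⟩
  linear_combination a.prop

/-- If `θ` is a quadratic irrationality with Galois conjugate `θ'` and `|θ - θ'| < 1`,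
then for every integer `0 ≤ ε ≤ 2` there exists `g ∈ S_θ` with `c > a + d + ε`. -/
theorem stmt_11 (θ θ' : ℝ) (hθ : Irrational θ) (hne : θ' ≠ θ) (p q : ℚ)
    (hroot : θ ^ 2 + (p : ℝ) * θ + (q : ℝ) = 0)
    (hroot' : θ' ^ 2 + (p : ℝ) * θ' + (q : ℝ) = 0)
    (hlt : |θ - θ'| < 1) :
    ∀ ε : ℤ, 0 ≤ ε → ε ≤ 2 →
      ∃ g : Matrix.SpecialLinearGroup (Fin 2) ℤ,
        g.1 ≠ 1 ∧ g.1 ≠ -1 ∧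
        ((g.1 0 0 : ℝ) * θ + (g.1 0 1 : ℝ)) / ((g.1 1 0 : ℝ) * θ + (g.1 1 1 : ℝ)) = θ ∧
        0 < g.1 0 0 + g.1 1 1 ∧ 0 < g.1 1 0 ∧ g.1 0 0 + g.1 1 1 + ε < g.1 1 0 := by
  intro ε _ hε
  obtain ⟨A, B, C, hA, hABC, hdisc⟩ :=
    exists_int_quadratic_of_conj_dist_lt_one hne hroot hroot' hlt
  obtain ⟨x, y, hx, hy, hxy⟩ :=
    exists_pell_of_irrational_root hθ hA.ne' hABC (M := 4 * A + 5) (by positivity)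
  have hy0 : 0 < y := by linarith
  have hc : 0 < 2 * A * y := by positivity
  have hdy : (B ^ 2 - 4 * A * C + 1) * y ^ 2 ≤ A ^ 2 * y ^ 2 :=
    mul_le_mul_of_nonneg_right hdisc (sq_nonneg y)
  have hxle : x ≤ A * y := by
    refine (sq_le_sq₀ (by positivity) (by positivity)).mp ?_
    nlinarith
  have hxlt : x + 2 ≤ A * y := by
    refine (sq_le_sq₀ (by positivity) (by positivity)).mp ?_
    nlinarith
  refine ⟨⟨!![x - B * y, -2 * C * y; 2 * A * y, x + B * y], ?_⟩, ?_, ?_, ?_, ?_, ?_, ?_⟩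
  · rw [Matrix.det_fin_two_of]
    linear_combination hxy
  · intro h
    have h10 := congrFun (congrFun h 1) 0
    simp at h10
    omega
  · intro h
    have h10 := congrFun (congrFun h 1) 0
    simp at h10
    omega
  · have hden := hθ.int_mul_add_int_ne_zero hc.ne' (x + B * y)
    simp only [Matrix.of_apply, Matrix.cons_val', Matrix.cons_val_zero, Matrix.cons_val_one,
      Matrix.cons_val_fin_one]
    rw [div_eq_iff hden]
    push_cast
    linear_combination -2 * (y : ℝ) * hABC
  · simp
    omega
  · simpa using hc
  · simp
    linarith
end

section
/- Let θ be a quadratic irrationality with Galois conjugate θ'. Then |θ − θ'| < 1 if and only if there exists g = [[a,b],[c,d]] ∈ SL₂(ℤ) with g ≠ ±I, (aθ+b)/(cθ+d) = θ, a+d > 0, c > 0, and c ≥ a + d. -/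
/-- If monic rational quadratics both vanish at an irrational number, they agree. -/
theorem Irrational.monic_quadratic_unique {θ : ℝ} (hθ : Irrational θ) {p q r s : ℚ}
    (h₁ : θ ^ 2 + (p : ℝ) * θ + (q : ℝ) = 0) (h₂ : θ ^ 2 + (r : ℝ) * θ + (s : ℝ) = 0) :
    p = r ∧ q = s := by
  have hpr : p = r := by
    by_contra hne
    have hne' : ((p : ℝ) - r) ≠ 0 := sub_ne_zero.mpr (by exact_mod_cast hne)
    refine hθ ⟨(s - q) / (p - r), ?_⟩
    push_cast
    rw [div_eq_iff hne']
    linarith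
  subst hpr
  exact ⟨rfl, by exact_mod_cast (by linarith : (q : ℝ) = s)⟩

/-- A monic rational quadratic has a positive integer multiple with integer coefficients. -/
theorem exists_int_coeffs_of_monic_quadratic (p q : ℚ) :
    ∃ A B C : ℤ, 0 < A ∧ (B : ℝ) = A * p ∧ (C : ℝ) = A * q := by
  refine ⟨p.den * q.den, p.num * q.den, q.num * p.den, ?_, ?_, ?_⟩
  · exact_mod_cast Nat.mul_pos p.pos q.pos
  · have h : (p : ℝ) * p.den = p.num := by exact_mod_cast Rat.mul_den_eq_num p
    push_cast
    rw [← h]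
    ring
  · have h : (q : ℝ) * q.den = q.num := by exact_mod_cast Rat.mul_den_eq_num q
    push_cast
    rw [← h]
    ring


/-- For a quadratic irrationality `θ` with Galois conjugate `θ'`, one has `|θ - θ'| < 1`
iff there exists `g ∈ S_θ` with `c ≥ a + d`. -/
theorem stmt_12 (θ θ' : ℝ) (hθ : Irrational θ) (hne : θ' ≠ θ) (p q : ℚ)
    (hroot : θ ^ 2 + (p : ℝ) * θ + (q : ℝ) = 0)
    (hroot' : θ' ^ 2 + (p : ℝ) * θ' + (q : ℝ) = 0) :
    |θ - θ'| < 1 ↔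
      ∃ g : Matrix.SpecialLinearGroup (Fin 2) ℤ,
        g.1 ≠ 1 ∧ g.1 ≠ -1 ∧
        ((g.1 0 0 : ℝ) * θ + (g.1 0 1 : ℝ)) / ((g.1 1 0 : ℝ) * θ + (g.1 1 1 : ℝ)) = θ ∧
        0 < g.1 0 0 + g.1 1 1 ∧ 0 < g.1 1 0 ∧ g.1 0 0 + g.1 1 1 ≤ g.1 1 0 := by
  have hsum : θ + θ' = -p := by
    have h : (θ' - θ) * (θ + θ' + p) = 0 := by linear_combination hroot' - hroot
    rcases mul_eq_zero.mp h with h | h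
    · exact absurd (sub_eq_zero.mp h) hne
    · linarith
  have hdisc : (θ - θ') ^ 2 = (p : ℝ) ^ 2 - 4 * q := by
    rw [show θ' = -p - θ by linarith]
    linear_combination 4 * hroot
  constructor
  · intro hlt
    rw [← sq_lt_one_iff_abs_lt_one, hdisc] at hlt
    obtain ⟨A, B, C, hA, hB, hC⟩ := exists_int_coeffs_of_monic_quadratic p q
    have hAR : (0 : ℝ) < A := by exact_mod_cast hA
    have hD : ((B ^ 2 - 4 * A * C : ℤ) : ℝ) = (A : ℝ) ^ 2 * ((p : ℝ) ^ 2 - 4 * q) := by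
      push_cast
      rw [hB, hC]
      ring
    have hDpos : 0 < B ^ 2 - 4 * A * C := by
      have h : 0 < (θ - θ') ^ 2 := by
        have := sub_ne_zero.mpr hne.symm
        positivity
      have : (0 : ℝ) < ((B ^ 2 - 4 * A * C : ℤ) : ℝ) := by
        rw [hD, ← hdisc]
        positivity
      exact_mod_cast this
    have hDlt : B ^ 2 - 4 * A * C < A ^ 2 := by
      have : ((B ^ 2 - 4 * A * C : ℤ) : ℝ) < ((A ^ 2 : ℤ) : ℝ) := by
        rw [hD]
        push_cast
        exact mul_lt_of_lt_one_right (by positivity) hlt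
      exact_mod_cast this
    have hirr (s : ℤ) : 2 * A * θ + B ≠ s := by
      intro h
      refine hθ ⟨(s - B) / (2 * A), ?_⟩
      push_cast
      rw [div_eq_iff (by positivity)]
      linarith
    have hDsq : ¬ IsSquare (B ^ 2 - 4 * A * C) := by
      rintro ⟨s, hs⟩
      have hs' : (s : ℝ) * s = (A : ℝ) ^ 2 * ((p : ℝ) ^ 2 - 4 * q) := by
        rw [← hD, hs]
        push_cast
        ring
      have h : (2 * A * θ + B) ^ 2 = (s : ℝ) ^ 2 := by
        rw [hB]
        linear_combination 4 * (A : ℝ) ^ 2 * hroot - hs'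
      rcases sq_eq_sq_iff_eq_or_eq_neg.mp h with h | h
      · exact hirr s h
      · exact hirr (-s) (by push_cast; exact h)
    obtain ⟨x₀, y₀, hxy₀, hy₀⟩ := Pell.exists_of_not_isSquare hDpos hDsq
    obtain ⟨x, y, hx, hy, hxy⟩ :
        ∃ x y : ℤ, 0 ≤ x ∧ 0 < y ∧ x ^ 2 - (B ^ 2 - 4 * A * C) * y ^ 2 = 1 :=
      ⟨|x₀|, |y₀|, abs_nonneg _, abs_pos.mpr hy₀, by simpa only [sq_abs] using hxy₀⟩
    have hxpos : 0 < x := by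
      have h : 0 < (B ^ 2 - 4 * A * C) * y ^ 2 := by positivity
      refine lt_of_le_of_ne hx fun h0 => ?_
      rw [← h0] at hxy
      linarith
    have hle : x ≤ A * y := by
      refine (sq_le_sq₀ hx (by positivity)).mp ?_
      have h : (B ^ 2 - 4 * A * C + 1) * y ^ 2 ≤ A ^ 2 * y ^ 2 :=
        mul_le_mul_of_nonneg_right hDlt (sq_nonneg y)
      have hy1 : 1 ≤ y ^ 2 := one_le_pow₀ hy
      linarith [mul_pow A y 2]
    have hAy : 0 < A * y := mul_pos hA hy
    refine ⟨⟨!![x - B * y, -(2 * C * y); 2 * A * y, x + B * y], ?_⟩, ?_, ?_, ?_, ?_, ?_, ?_⟩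
    · rw [Matrix.det_fin_two_of]
      linear_combination hxy
    · intro h
      have := congrFun (congrFun h 1) 0
      simp at this
      omega
    · intro h
      have := congrFun (congrFun h 1) 0
      simp at this
      omega
    · have hden : (2 * A * y : ℝ) * θ + (x + B * y) ≠ 0 := by
        intro h
        refine hθ ⟨-(x + B * y) / (2 * A * y), ?_⟩
        have hyR : (0 : ℝ) < y := by exact_mod_cast hy
        push_cast
        rw [div_eq_iff (by positivity)]
        linarith
      simp only [Matrix.of_apply, Matrix.cons_val', Matrix.cons_val_zero, Matrix.cons_val_one,
        Matrix.cons_val_fin_one]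
      push_cast
      rw [div_eq_iff hden, hB, hC]
      linear_combination (-2 * (A : ℝ) * y) * hroot
    · simp
      linarith
    · simp
      linarith
    · simp
      linarith
  · rintro ⟨g, -, -, hfix, ht, hc, htc⟩
    have hdet := g.2
    rw [Matrix.det_fin_two] at hdet
    generalize g.1 0 0 = a at *
    generalize g.1 0 1 = b at *
    generalize g.1 1 0 = c at *
    generalize g.1 1 1 = d at *
    have hcR : (0 : ℝ) < c := by exact_mod_cast hc
    have hden : (c : ℝ) * θ + d ≠ 0 := by
      intro h
      rw [h, div_zero] at hfix
      exact hθ ⟨0, by simpa using hfix⟩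
    rw [div_eq_iff hden] at hfix
    have hquad : θ ^ 2 + (((d - a) / c : ℚ) : ℝ) * θ + ((-b / c : ℚ) : ℝ) = 0 := by
      push_cast
      field_simp
      linarith
    obtain ⟨rfl, rfl⟩ := hθ.monic_quadratic_unique hroot hquad
    rw [← sq_lt_one_iff_abs_lt_one, hdisc]
    have hdetR : (a : ℝ) * d - b * c = 1 := by exact_mod_cast hdet
    have htR : (0 : ℝ) < a + d := by exact_mod_cast ht
    have htcR : (a : ℝ) + d ≤ c := by exact_mod_cast htc
    have heq : ((((d - a) / c : ℚ) : ℝ)) ^ 2 - 4 * ((-b / c : ℚ) : ℝ)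
        = ((a + d) ^ 2 - 4) / (c : ℝ) ^ 2 := by
      push_cast
      field_simp
      linear_combination -4 * hdetR
    rw [heq, div_lt_one (by positivity)]
    linarith [pow_le_pow_left₀ htR.le htcR 2]
end

section
/- Let θ ∈ ℝ be irrational and Γ = ℤ + θℤ ⊆ ℝ. There exists a real number α ∉ ℤ with α·Γ ⊆ Γ if and only if θ is a quadratic irrationality. -/
theorem mem_closure_one_pair {θ x : ℝ} :
    x ∈ AddSubgroup.closure ({1, θ} : Set ℝ) ↔ ∃ m n : ℤ, (m : ℝ) + n * θ = x := by
  simp [AddSubgroup.mem_closure_pair]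

/-- A rational quadratic relation can be rescaled to an integral one. -/
theorem exists_int_quadratic {θ : ℝ} {a b c : ℚ} (ha : a ≠ 0)
    (h : (a : ℝ) * θ ^ 2 + (b : ℝ) * θ + (c : ℝ) = 0) :
    ∃ A B C : ℤ, A ≠ 0 ∧ (A : ℝ) * θ ^ 2 + B * θ + C = 0 := by
  refine ⟨a.num * b.den * c.den, b.num * a.den * c.den, c.num * a.den * b.den, ?_, ?_⟩
  · simp [ha]
  · have hda : (a.den : ℝ) ≠ 0 := by simp
    have hdb : (b.den : ℝ) ≠ 0 := by simp
    have hdc : (c.den : ℝ) ≠ 0 := by simp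
    rw [Rat.cast_def a, Rat.cast_def b, Rat.cast_def c] at h
    field_simp at h
    push_cast
    linear_combination h

/-- For irrational `θ` and `Γ = ℤ + θℤ`, there is a non-integer real multiplier of `Γ`
iff `θ` is a quadratic irrationality. -/
theorem stmt_14 (θ : ℝ) (hθ : Irrational θ) :
    (∃ α : ℝ, (∀ m : ℤ, α ≠ (m : ℝ)) ∧
      ∀ γ ∈ AddSubgroup.closure ({1, θ} : Set ℝ),
        α * γ ∈ AddSubgroup.closure ({1, θ} : Set ℝ)) ↔
    (∃ a b c : ℚ, a ≠ 0 ∧ (a : ℝ) * θ ^ 2 + (b : ℝ) * θ + (c : ℝ) = 0) := by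
  constructor
  · rintro ⟨α, hα, h⟩
    obtain ⟨m, n, hmn⟩ :=
      mem_closure_one_pair.1 (h 1 (AddSubgroup.subset_closure (by simp)))
    obtain ⟨p, q, hpq⟩ :=
      mem_closure_one_pair.1 (h θ (AddSubgroup.subset_closure (by simp)))
    refine ⟨n, m - q, -p, ?_, ?_⟩
    · intro hn
      have hn' : n = 0 := by exact_mod_cast hn
      apply hα m
      simpa [hn'] using hmn.symm
    · push_cast
      linear_combination θ * hmn - hpq
  · rintro ⟨a, b, c, ha, h⟩
    obtain ⟨A, B, C, hA, hABC⟩ := exists_int_quadratic ha h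
    refine ⟨A * θ, fun m => (hθ.intCast_mul hA).ne_int m, fun γ hγ => ?_⟩
    obtain ⟨m, n, rfl⟩ := mem_closure_one_pair.1 hγ
    refine mem_closure_one_pair.2 ⟨-(n * C), m * A - n * B, ?_⟩
    push_cast
    linear_combination -n * hABC
end

section
/- Let k be a real quadratic field (a number field of degree 2 over ℚ admitting a real embedding, equivalently with θ-generator a real quadratic irrationality), let O_k be its ring of integers, and let f ≥ 1 be an integer. Then there exists a unit ε of O_k of infinite order (in particular ε ≠ ±1) such that ε ∈ ℤ + f·O_k, i.e. ε = m + f·β for some m ∈ ℤ and β ∈ O_k. -/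
open NumberField NumberField.InfinitePlace in
/-- A quadratic number field with a real embedding has unit rank one. -/
theorem NumberField.Units.rank_eq_one_of_finrank_eq_two {K : Type*} [Field K] [NumberField K]
    (hK : Module.finrank ℚ K = 2) (φ : K →+* ℝ) : Units.rank K = 1 := by
  classical
  have hreal : IsReal (InfinitePlace.mk (Complex.ofRealHom.comp φ)) :=
    ⟨Complex.ofRealHom.comp φ, by ext x; simp, rfl⟩
  have hpos : 0 < nrRealPlaces K := Fintype.card_pos_iff.mpr ⟨⟨_, hreal⟩⟩
  have hadd := card_add_two_mul_card_eq_rank K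
  have hcard := card_eq_nrRealPlaces_add_nrComplexPlaces K
  unfold Units.rank
  omega

open NumberField in
/-- A number field of positive unit rank has a unit of infinite order. -/
theorem NumberField.Units.exists_not_isOfFinOrder {K : Type*} [Field K] [NumberField K]
    (h : 0 < Units.rank K) : ∃ u : (𝓞 K)ˣ, ¬ IsOfFinOrder u := by
  refine ⟨Units.fundSystem K ⟨0, h⟩, fun hfin ↦ (Units.basisUnitLattice K).ne_zero ⟨0, h⟩ ?_⟩
  rw [← Submodule.coe_eq_zero, ← Units.logEmbedding_fundSystem]
  exact Units.dirichletUnitTheorem.logEmbedding_eq_zero_iff.mpr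
    ((CommGroup.mem_torsion _).mpr hfin)

open NumberField in
/-- Some positive power of a unit is congruent to `1` modulo a given nonzero integer. -/
theorem NumberField.Units.exists_pow_eq_one_add_mul {K : Type*} [Field K] [NumberField K]
    {f : ℤ} (hf : f ≠ 0) (u : (𝓞 K)ˣ) :
    ∃ n : ℕ, 0 < n ∧ ∃ β : 𝓞 K, ((u ^ n : (𝓞 K)ˣ) : 𝓞 K) = 1 + (f : 𝓞 K) * β := by
  set I : Ideal (𝓞 K) := Ideal.span {(f : 𝓞 K)}
  have hI : I ≠ ⊥ := by
    rw [Ne, Ideal.span_singleton_eq_bot]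
    exact_mod_cast hf
  have : Finite (𝓞 K ⧸ I) := Ideal.finiteQuotientOfFreeOfNeBot I hI
  obtain ⟨n, hn, hpow⟩ := isOfFinOrder_iff_pow_eq_one.mp
    (isOfFinOrder_of_finite (Units.map (Ideal.Quotient.mk I : 𝓞 K →* 𝓞 K ⧸ I) u))
  refine ⟨n, hn, ?_⟩
  have hmk : Ideal.Quotient.mk I ((u ^ n : (𝓞 K)ˣ) : 𝓞 K) = Ideal.Quotient.mk I 1 := by
    simpa using congrArg Units.val hpow
  obtain ⟨β, hβ⟩ := Ideal.mem_span_singleton'.mp (Ideal.Quotient.eq.mp hmk)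
  exact ⟨β, by linear_combination -hβ⟩

/-- Let `K ⊆ ℝ` be a real quadratic field with ring of integers `O_K`, and `f ≥ 1`
an integer. Then there is a unit `ε` of `O_K` of infinite order (in particular
`ε ≠ ±1`) lying in `ℤ + f·O_K`. -/
theorem stmt_15 (K : IntermediateField ℚ ℝ) (hK : Module.finrank ℚ K = 2)
    (f : ℤ) (hf : 1 ≤ f) :
    ∃ ε : (integralClosure ℤ K)ˣ, ¬ IsOfFinOrder ε ∧ ε ≠ 1 ∧ ε ≠ -1 ∧
      ∃ (m : ℤ) (β : integralClosure ℤ K),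
        (ε : integralClosure ℤ K) = (m : integralClosure ℤ K) + (f : integralClosure ℤ K) * β := by
  have : FiniteDimensional ℚ K := Module.finite_of_finrank_eq_succ hK
  have : NumberField K := ⟨⟩
  have hrank := NumberField.Units.rank_eq_one_of_finrank_eq_two hK (algebraMap K ℝ)
  obtain ⟨u, hu⟩ := NumberField.Units.exists_not_isOfFinOrder (K := K) (by omega)
  obtain ⟨n, hn, β, hβ⟩ := NumberField.Units.exists_pow_eq_one_add_mul (f := f) (by omega) u
  have hinf : ¬ IsOfFinOrder (u ^ n) := fun h ↦ hu (h.of_pow hn.ne')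
  refine ⟨u ^ n, hinf, ?_, ?_, 1, β, ?_⟩
  · intro h
    exact hinf (h ▸ IsOfFinOrder.one)
  · intro h
    refine hinf (isOfFinOrder_iff_pow_eq_one.mpr ⟨2, two_pos, ?_⟩)
    exact (congrArg (· ^ 2) h).trans neg_one_sq
  · rw [Int.cast_one]
    exact hβ
end
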